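/- For the free Fermi gas eigenstate Ψ_k with distinct momenta, the variance of N_Γ satisfies ⟨Ψ_k, N_Γ² Ψ_k⟩ − ⟨Ψ_k, N_Γ Ψ_k⟩² ≤ N·(|Γ|/|Λ|)·(1 − |Γ|/|Λ|). -/

import Mathlib

open scoped InnerProductSpace Real

/-- `k·x` for a momentum `k ∈ ℝ^d` and a lattice site `x ∈ {1,…,L}^d`. -/
def kdot (d L : ℕ) (k : Fin d → ℝ) (x : Fin d → Fin L) : ℝ :=
  ∑ a : Fin d, k a * ((x a : ℕ) + 1)

/-- The creation operator `a†_k := L^{-d/2} Σ_{x∈Λ} e^{ik·x} c†_x`. -/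
noncomputable def adag (d L : ℕ) {H : Type*} [NormedAddCommGroup H]
    [InnerProductSpace ℂ H] (cd : (Fin d → Fin L) → (H →ₗ[ℂ] H)) (k : Fin d → ℝ) :
    H →ₗ[ℂ] H :=
  ((Real.sqrt ((L : ℝ) ^ d) : ℂ))⁻¹ •
    ∑ x : Fin d → Fin L, Complex.exp (Complex.I * kdot d L k x) • cd x

/-- Membership in the discrete momentum lattice `𝒦`: every component is an integer
multiple of `2π/L` lying in `(-π, π]`. -/
def inMomentumLattice (d L : ℕ) (k : Fin d → ℝ) : Prop :=
  ∀ a : Fin d, (∃ ν : ℤ, k a = 2 * π * ν / L) ∧ -π < k a ∧ k a ≤ π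

open scoped ComplexConjugate

section CAR

variable {X : Type*} {H : Type*} [NormedAddCommGroup H] [InnerProductSpace ℂ H]

/-- A representation of the canonical anticommutation relations over the sites `X`. -/
structure IsCAR [DecidableEq X] (c cd : X → (H →ₗ[ℂ] H)) : Prop where
  adjoint : ∀ x φ ψ, ⟪cd x φ, ψ⟫_ℂ = ⟪φ, c x ψ⟫_ℂ
  anticomm : ∀ x y, c x * c y + c y * c x = 0
  anticomm_cd : ∀ x y, c x * cd y + cd y * c x = if x = y then (1 : H →ₗ[ℂ] H) else 0

lemma IsCAR.inner_number [DecidableEq X] {c cd : X → (H →ₗ[ℂ] H)} (h : IsCAR c cd)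
    (Γ : Finset X) (φ ψ : H) :
    ⟪(∑ x ∈ Γ, cd x * c x) φ, ψ⟫_ℂ = ⟪φ, (∑ x ∈ Γ, cd x * c x) ψ⟫_ℂ := by
  have hadj' (x : X) (φ ψ : H) : ⟪c x φ, ψ⟫_ℂ = ⟪φ, cd x ψ⟫_ℂ := by
    rw [← inner_conj_symm, ← h.adjoint, inner_conj_symm]
  simp [LinearMap.sum_apply, h.adjoint, hadj']

variable [Fintype X]

/-- The smeared creation operator `Σ_x v(x) c†_x`. -/
def creation (cd : X → (H →ₗ[ℂ] H)) : EuclideanSpace ℂ X →ₗ[ℂ] (H →ₗ[ℂ] H) where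
  toFun v := ∑ x, v x • cd x
  map_add' v w := by simp [add_smul, Finset.sum_add_distrib]
  map_smul' a v := by simp [mul_smul, Finset.smul_sum]

/-- The smeared annihilation operator `Σ_x conj (v(x)) c_x`. -/
def annihilation (c : X → (H →ₗ[ℂ] H)) :
    EuclideanSpace ℂ X →ₛₗ[starRingEnd ℂ] (H →ₗ[ℂ] H) where
  toFun v := ∑ x, conj (v x) • c x
  map_add' v w := by simp [add_smul, Finset.sum_add_distrib]
  map_smul' a v := by simp [mul_smul, Finset.smul_sum]

lemma creation_apply (cd : X → (H →ₗ[ℂ] H)) (v : EuclideanSpace ℂ X) (φ : H) :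
    creation cd v φ = ∑ x, v x • cd x φ := by
  simp [creation]

lemma annihilation_apply (c : X → (H →ₗ[ℂ] H)) (v : EuclideanSpace ℂ X) (φ : H) :
    annihilation c v φ = ∑ x, conj (v x) • c x φ := by
  simp [annihilation]

/-- The Slater determinant state obtained by filling the modes in `l`. -/
def slater (cd : X → (H →ₗ[ℂ] H)) (vac : H) (l : List (EuclideanSpace ℂ X)) : H :=
  (l.map (creation cd)).prod vac

lemma slater_cons (cd : X → (H →ₗ[ℂ] H)) (vac : H) (v : EuclideanSpace ℂ X)
    (l : List (EuclideanSpace ℂ X)) :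
    slater cd vac (v :: l) = creation cd v (slater cd vac l) := by
  simp [slater]

namespace IsCAR

variable [DecidableEq X] {c cd : X → (H →ₗ[ℂ] H)}

lemma inner_creation (h : IsCAR c cd) (v : EuclideanSpace ℂ X) (φ ψ : H) :
    ⟪creation cd v φ, ψ⟫_ℂ = ⟪φ, annihilation c v ψ⟫_ℂ := by
  simp [creation_apply, annihilation_apply, h.adjoint, mul_comm]

lemma annihilation_anticomm (h : IsCAR c cd) (v w : EuclideanSpace ℂ X) (φ : H) :
    annihilation c v (annihilation c w φ) = -annihilation c w (annihilation c v φ) := by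
  have hc (x y : X) : c x (c y φ) = -c y (c x φ) :=
    eq_neg_of_add_eq_zero_left (by simpa using LinearMap.congr_fun (h.anticomm x y) φ)
  simp only [annihilation_apply, map_sum, map_smul, Finset.smul_sum]
  rw [Finset.sum_comm, ← Finset.sum_neg_distrib]
  refine Finset.sum_congr rfl fun y _ => ?_
  rw [← Finset.sum_neg_distrib]
  refine Finset.sum_congr rfl fun x _ => ?_
  rw [hc, smul_neg, smul_neg, smul_comm]

lemma creation_anticomm (h : IsCAR c cd) (v w : EuclideanSpace ℂ X) (φ : H) :
    creation cd v (creation cd w φ) = -creation cd w (creation cd v φ) := by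
  refine ext_inner_right ℂ fun ψ => ?_
  rw [inner_neg_left]
  simp only [h.inner_creation]
  rw [h.annihilation_anticomm, inner_neg_right]

lemma annihilation_creation (h : IsCAR c cd) (v w : EuclideanSpace ℂ X) (φ : H) :
    annihilation c v (creation cd w φ) =
      ⟪v, w⟫_ℂ • φ - creation cd w (annihilation c v φ) := by
  have hc (x y : X) : c x (cd y φ) = (if x = y then φ else 0) - cd y (c x φ) := by
    have := LinearMap.congr_fun (h.anticomm_cd x y) φ
    rw [eq_sub_iff_add_eq]
    split_ifs at this ⊢ <;> simpa using this
  simp only [annihilation_apply, creation_apply, map_sum, map_smul, Finset.smul_sum, hc,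
    smul_sub, Finset.sum_sub_distrib]
  congr 1
  · simp [PiLp.inner_apply, Finset.sum_smul, smul_smul]
  · rw [Finset.sum_comm]
    refine Finset.sum_congr rfl fun y _ => Finset.sum_congr rfl fun x _ => smul_comm _ _ _

lemma creation_creation_self (h : IsCAR c cd) (v : EuclideanSpace ℂ X) (φ : H) :
    creation cd v (creation cd v φ) = 0 := by
  have h2 : (2 : ℂ) • creation cd v (creation cd v φ) = 0 := by
    rw [two_smul]
    exact eq_neg_iff_add_eq_zero.mp (h.creation_anticomm v v φ)
  simpa using h2

variable {vac : H}

lemma annihilation_slater_eq_zero (h : IsCAR c cd) (hvac0 : ∀ x, c x vac = 0)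
    {v : EuclideanSpace ℂ X} {l : List (EuclideanSpace ℂ X)} (hv : ∀ w ∈ l, ⟪v, w⟫_ℂ = 0) :
    annihilation c v (slater cd vac l) = 0 := by
  induction l with
  | nil => simp [slater, annihilation_apply, hvac0]
  | cons w l ih =>
    rw [slater_cons, h.annihilation_creation, hv w (by simp),
      ih fun u hu => hv u (List.mem_cons_of_mem _ hu)]
    simp

lemma creation_slater_eq_zero (h : IsCAR c cd) {v : EuclideanSpace ℂ X}
    {l : List (EuclideanSpace ℂ X)} (hv : v ∈ l) :
    creation cd v (slater cd vac l) = 0 := by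
  induction l with
  | nil => simp at hv
  | cons w l ih =>
    rw [slater_cons]
    rcases List.mem_cons.mp hv with rfl | hv
    · exact h.creation_creation_self _ _
    · rw [h.creation_anticomm, ih hv, map_zero, neg_zero]

lemma norm_slater (h : IsCAR c cd) (hvac : ‖vac‖ = 1) (hvac0 : ∀ x, c x vac = 0)
    {l : List (EuclideanSpace ℂ X)} (hl : l.Pairwise fun v w => ⟪v, w⟫_ℂ = 0)
    (hl' : ∀ v ∈ l, ‖v‖ = 1) : ‖slater cd vac l‖ = 1 := by
  induction l with
  | nil => simpa [slater] using hvac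
  | cons w l ih =>
    rw [List.pairwise_cons] at hl
    have ih := ih hl.2 fun v hv => hl' v (List.mem_cons_of_mem _ hv)
    have hw := hl' w (by simp)
    have key : ⟪slater cd vac (w :: l), slater cd vac (w :: l)⟫_ℂ = 1 := by
      rw [slater_cons, h.inner_creation, h.annihilation_creation,
        h.annihilation_slater_eq_zero hvac0 hl.1, map_zero, sub_zero, inner_smul_right,
        inner_self_eq_norm_sq_to_K, inner_self_eq_norm_sq_to_K, ih, hw]
      simp
    have : ‖slater cd vac (w :: l)‖ ^ 2 = 1 := by
      rw [← inner_self_eq_norm_sq (𝕜 := ℂ), key]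
      simp
    exact (pow_eq_one_iff_of_nonneg (norm_nonneg _) two_ne_zero).mp this

end IsCAR

end CAR

section Residual

variable {E : Type*} [NormedAddCommGroup E] [InnerProductSpace ℂ E] {ι : Type*} [Fintype ι]

/-- The part of `v` orthogonal to the span of the orthonormal family `f`. -/
noncomputable def orthogonalResidual (f : ι → E) (v : E) : E := v - ∑ i, ⟪f i, v⟫_ℂ • f i

lemma inner_orthogonalResidual {f : ι → E} (hf : Orthonormal ℂ f) (v : E) (i : ι) :
    ⟪orthogonalResidual f v, f i⟫_ℂ = 0 := by
  rw [← inner_conj_symm, orthogonalResidual, inner_sub_right, hf.inner_right_fintype]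
  simp

lemma norm_orthogonalResidual_sq_le {f : ι → E} (hf : Orthonormal ℂ f) (v : E) (i : ι) :
    ‖orthogonalResidual f v‖ ^ 2 ≤ ‖v‖ ^ 2 - ‖⟪f i, v⟫_ℂ‖ ^ 2 := by
  have horth : ⟪orthogonalResidual f v, ∑ i, ⟪f i, v⟫_ℂ • f i⟫_ℂ = 0 := by
    simp [inner_orthogonalResidual hf]
  have hpyth := norm_add_sq_eq_norm_sq_add_norm_sq_of_inner_eq_zero _ _ horth
  have hv : orthogonalResidual f v + ∑ i, ⟪f i, v⟫_ℂ • f i = v := sub_add_cancel _ _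
  have hi : ‖⟪f i, v⟫_ℂ‖ ≤ ‖∑ i, ⟪f i, v⟫_ℂ • f i‖ := by
    conv_lhs => rw [← hf.inner_right_fintype (fun i => ⟪f i, v⟫_ℂ) i]
    simpa [hf.1 i] using norm_inner_le_norm (𝕜 := ℂ) (f i) (∑ i, ⟪f i, v⟫_ℂ • f i)
  rw [hv] at hpyth
  nlinarith [norm_nonneg ⟪f i, v⟫_ℂ]

end Residual

namespace IsCAR

variable {X : Type*} [Fintype X] [DecidableEq X] {H : Type*} [NormedAddCommGroup H]
  [InnerProductSpace ℂ H] {c cd : X → (H →ₗ[ℂ] H)} {vac : H} {N : ℕ}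
  {f : Fin N → EuclideanSpace ℂ X}

lemma annihilation_slater (h : IsCAR c cd) (hvac0 : ∀ x, c x vac = 0) (hf : Orthonormal ℂ f)
    (v : EuclideanSpace ℂ X) :
    annihilation c v (slater cd vac (List.ofFn f)) =
      ∑ i, ⟪v, f i⟫_ℂ • annihilation c (f i) (slater cd vac (List.ofFn f)) := by
  have h0 := h.annihilation_slater_eq_zero hvac0 (v := orthogonalResidual f v) (l := List.ofFn f)
    (by simpa [List.mem_ofFn] using inner_orthogonalResidual hf v)
  simpa [orthogonalResidual, sub_eq_zero, map_smulₛₗ] using h0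

lemma creation_annihilation_slater (h : IsCAR c cd) (hf : Orthonormal ℂ f) (i j : Fin N) :
    creation cd (f i) (annihilation c (f j) (slater cd vac (List.ofFn f))) =
      if j = i then slater cd vac (List.ofFn f) else 0 := by
  have h1 := h.annihilation_creation (f j) (f i) (slater cd vac (List.ofFn f))
  rw [h.creation_slater_eq_zero (List.mem_ofFn.mpr ⟨i, rfl⟩), map_zero,
    orthonormal_iff_ite.mp hf] at h1
  rw [← sub_eq_zero.mp h1.symm]
  split_ifs <;> simp

lemma norm_slater_ofFn (h : IsCAR c cd) (hvac : ‖vac‖ = 1) (hvac0 : ∀ x, c x vac = 0)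
    (hf : Orthonormal ℂ f) : ‖slater cd vac (List.ofFn f)‖ = 1 := by
  refine h.norm_slater hvac hvac0 ?_ ?_
  · rw [List.pairwise_ofFn]
    exact fun i j hij => hf.2 hij.ne
  · simpa [List.mem_ofFn] using hf.1

/-- Replacing each occupied mode `f i` by `g i` in turn: the part along the state itself. -/
lemma sum_creation_annihilation_slater (h : IsCAR c cd) (hf : Orthonormal ℂ f)
    (g : Fin N → EuclideanSpace ℂ X) :
    ∑ i, creation cd (g i) (annihilation c (f i) (slater cd vac (List.ofFn f))) =
      (∑ i, ⟪f i, g i⟫_ℂ) • slater cd vac (List.ofFn f) +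
        ∑ i, creation cd (orthogonalResidual f (g i))
          (annihilation c (f i) (slater cd vac (List.ofFn f))) := by
  rw [Finset.sum_smul, ← Finset.sum_add_distrib]
  refine Finset.sum_congr rfl fun i _ => ?_
  simp [orthogonalResidual, h.creation_annihilation_slater hf]

lemma norm_sum_creation_annihilation_slater_sq (h : IsCAR c cd) (hvac : ‖vac‖ = 1)
    (hvac0 : ∀ x, c x vac = 0) (hf : Orthonormal ℂ f) {g : Fin N → EuclideanSpace ℂ X}
    (hg : ∀ i j, ⟪g i, f j⟫_ℂ = 0) :
    ‖∑ i, creation cd (g i) (annihilation c (f i) (slater cd vac (List.ofFn f)))‖ ^ 2 =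
      ∑ i, ‖g i‖ ^ 2 := by
  have hΨ := h.norm_slater_ofFn hvac hvac0 hf
  have hterm (i j : Fin N) :
      ⟪creation cd (g i) (annihilation c (f i) (slater cd vac (List.ofFn f))),
        creation cd (g j) (annihilation c (f j) (slater cd vac (List.ofFn f)))⟫_ℂ =
        if j = i then (‖g i‖ : ℂ) ^ 2 else 0 := by
    rw [h.inner_creation, h.annihilation_creation, h.annihilation_anticomm (g i),
      h.annihilation_slater_eq_zero hvac0 (v := g i) (by simpa [List.mem_ofFn] using hg i),
      map_zero, neg_zero, map_zero, sub_zero, inner_smul_right, ← h.inner_creation,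
      h.creation_annihilation_slater hf]
    by_cases hij : i = j
    · subst hij
      simp [inner_self_eq_norm_sq_to_K, hΨ]
    · simp [hij, Ne.symm hij]
  rw [← inner_self_eq_norm_sq (𝕜 := ℂ), sum_inner]
  simp only [inner_sum, hterm]
  simp [← Complex.ofReal_pow]

lemma number_slater (h : IsCAR c cd) (hvac0 : ∀ x, c x vac = 0) (hf : Orthonormal ℂ f)
    (Γ : Finset X) :
    (∑ x ∈ Γ, cd x * c x) (slater cd vac (List.ofFn f)) =
      ∑ i, creation cd (WithLp.toLp 2 fun x => if x ∈ Γ then f i x else 0)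
        (annihilation c (f i) (slater cd vac (List.ofFn f))) := by
  have hc (x : X) : c x (slater cd vac (List.ofFn f)) =
      ∑ i, f i x • annihilation c (f i) (slater cd vac (List.ofFn f)) := by
    have := h.annihilation_slater hvac0 hf (EuclideanSpace.single x 1)
    rw [annihilation_apply] at this
    simpa [EuclideanSpace.inner_single_left, apply_ite] using this
  simp only [LinearMap.sum_apply, Module.End.mul_apply, hc, map_sum, map_smul, creation_apply]
  rw [Finset.sum_comm]
  refine Finset.sum_congr rfl fun i _ => ?_
  simp [ite_smul, Finset.sum_ite_mem]

/-- Variance of the particle number in `Γ` for a Slater determinant of modes which all have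
the weight `ρ` on `Γ`. -/
lemma number_variance_slater_le (h : IsCAR c cd) (hvac : ‖vac‖ = 1)
    (hvac0 : ∀ x, c x vac = 0) (hf : Orthonormal ℂ f) (Γ : Finset X) {ρ : ℝ}
    (hρ : ∀ i, ∑ x ∈ Γ, ‖f i x‖ ^ 2 = ρ) :
    (⟪slater cd vac (List.ofFn f), ((∑ x ∈ Γ, cd x * c x) * (∑ x ∈ Γ, cd x * c x))
        (slater cd vac (List.ofFn f))⟫_ℂ).re -
      ((⟪slater cd vac (List.ofFn f), (∑ x ∈ Γ, cd x * c x)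
        (slater cd vac (List.ofFn f))⟫_ℂ).re) ^ 2 ≤ N * ρ * (1 - ρ) := by
  set Ψ := slater cd vac (List.ofFn f) with hΨdef
  set g : Fin N → EuclideanSpace ℂ X :=
    fun i => WithLp.toLp 2 fun x => if x ∈ Γ then f i x else 0 with hg
  have hΨ : ‖Ψ‖ = 1 := h.norm_slater_ofFn hvac hvac0 hf
  have hgn (i : Fin N) : ‖g i‖ ^ 2 = ρ := by
    rw [EuclideanSpace.norm_sq_eq, ← hρ i]
    simp [hg, apply_ite, ite_pow, Finset.sum_ite_mem]
  have hfg (i : Fin N) : ⟪f i, g i⟫_ℂ = ρ := by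
    rw [PiLp.inner_apply, ← hρ i]
    simp [hg, ite_mul, Finset.sum_ite_mem, Complex.mul_conj']
  have hN : (∑ x ∈ Γ, cd x * c x) Ψ = ((N * ρ : ℝ) : ℂ) • Ψ +
      ∑ i, creation cd (orthogonalResidual f (g i)) (annihilation c (f i) Ψ) := by
    rw [hΨdef, h.number_slater hvac0 hf, h.sum_creation_annihilation_slater hf g]
    simp [hfg]
  have hR := h.norm_sum_creation_annihilation_slater_sq hvac hvac0 hf
    (g := fun i => orthogonalResidual f (g i)) fun i j => inner_orthogonalResidual hf (g i) j
  have hle : ∑ i, ‖orthogonalResidual f (g i)‖ ^ 2 ≤ N * ρ * (1 - ρ) := by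
    calc ∑ i, ‖orthogonalResidual f (g i)‖ ^ 2 ≤ ∑ _i : Fin N, (ρ - ρ ^ 2) := by
          refine Finset.sum_le_sum fun i _ => (norm_orthogonalResidual_sq_le hf (g i) i).trans_eq ?_
          simp [hgn, hfg]
      _ = N * ρ * (1 - ρ) := by simp; ring
  rw [Module.End.mul_apply, ← h.inner_number]
  rw [← sub_eq_iff_eq_add'] at hN
  rw [← hΨdef, ← hN] at hR
  rw [← hR, @norm_sub_sq ℂ] at hle
  have h1 : (⟪(∑ x ∈ Γ, cd x * c x) Ψ, (∑ x ∈ Γ, cd x * c x) Ψ⟫_ℂ).re =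
      ‖(∑ x ∈ Γ, cd x * c x) Ψ‖ ^ 2 := by
    rw [← inner_self_eq_norm_sq (𝕜 := ℂ)]; rfl
  have h2 : RCLike.re ⟪(∑ x ∈ Γ, cd x * c x) Ψ, ((N * ρ : ℝ) : ℂ) • Ψ⟫_ℂ =
      N * ρ * (⟪Ψ, (∑ x ∈ Γ, cd x * c x) Ψ⟫_ℂ).re := by
    rw [inner_smul_right, h.inner_number]
    simp
  have h3 : ‖((N * ρ : ℝ) : ℂ) • Ψ‖ ^ 2 = (N * ρ) ^ 2 := by
    rw [norm_smul, hΨ, mul_one, Complex.norm_real, Real.norm_eq_abs, sq_abs]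
  rw [h1]
  rw [h2, h3] at hle
  nlinarith [sq_nonneg (N * ρ - (⟪Ψ, (∑ x ∈ Γ, cd x * c x) Ψ⟫_ℂ).re)]

end IsCAR

/-- The normalized plane wave `L^{-d/2} e^{ik·x}`. -/
noncomputable def planeWave (d L : ℕ) (k : Fin d → ℝ) : EuclideanSpace ℂ (Fin d → Fin L) :=
  WithLp.toLp 2 fun x =>
    ((Real.sqrt ((L : ℝ) ^ d) : ℂ))⁻¹ * Complex.exp (Complex.I * kdot d L k x)

lemma creation_planeWave (d L : ℕ) {H : Type*} [NormedAddCommGroup H] [InnerProductSpace ℂ H]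
    (cd : (Fin d → Fin L) → (H →ₗ[ℂ] H)) (k : Fin d → ℝ) :
    creation cd (planeWave d L k) = adag d L cd k := by
  simp [creation, planeWave, adag, Finset.smul_sum, mul_smul]

lemma norm_planeWave_apply_sq (d L : ℕ) (k : Fin d → ℝ) (x : Fin d → Fin L) :
    ‖planeWave d L k x‖ ^ 2 = ((L : ℝ) ^ d)⁻¹ := by
  have h : (0 : ℝ) ≤ (L : ℝ) ^ d := by positivity
  simp [planeWave, mul_comm Complex.I, Complex.norm_exp_ofReal_mul_I, abs_of_nonneg, h]

lemma norm_planeWave {d L : ℕ} (hL : 0 < L) (k : Fin d → ℝ) : ‖planeWave d L k‖ = 1 := by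
  have h : ‖planeWave d L k‖ ^ 2 = 1 := by
    rw [EuclideanSpace.norm_sq_eq]
    have : (L : ℝ) ≠ 0 := by positivity
    simp [norm_planeWave_apply_sq, this]
  exact (pow_eq_one_iff_of_nonneg (norm_nonneg _) two_ne_zero).mp h

lemma sum_exp_eq_zero {L : ℕ} (hL : 0 < L) {p q : ℝ}
    (hp : (∃ ν : ℤ, p = 2 * π * ν / L) ∧ -π < p ∧ p ≤ π)
    (hq : (∃ ν : ℤ, q = 2 * π * ν / L) ∧ -π < q ∧ q ≤ π) (hpq : p ≠ q) :
    ∑ n : Fin L, Complex.exp (Complex.I * ((q - p) * ((n : ℕ) + 1) : ℝ)) = 0 := by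
  obtain ⟨⟨μ, hμ⟩, hp1, hp2⟩ := hp
  obtain ⟨⟨ν, hν⟩, hq1, hq2⟩ := hq
  have hL' : (L : ℝ) ≠ 0 := by positivity
  set z := Complex.exp (Complex.I * (q - p : ℝ)) with hz
  have hz1 : z ≠ 1 := by
    intro h1
    obtain ⟨m, hm⟩ := Complex.exp_eq_one_iff.mp h1
    have hm' : q - p = m * (2 * π) := by
      have : Complex.I * ((q - p : ℝ) : ℂ) = Complex.I * ((m * (2 * π) : ℝ) : ℂ) := by
        rw [hm]; push_cast; ring
      exact_mod_cast mul_left_cancel₀ Complex.I_ne_zero this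
    have hm1 : (m : ℝ) < 1 := by nlinarith [Real.pi_pos]
    have hm2 : (-1 : ℝ) < m := by nlinarith [Real.pi_pos]
    have hm0 : m = 0 := by
      have : m < 1 := by exact_mod_cast hm1
      have : -1 < m := by exact_mod_cast hm2
      omega
    rw [hm0] at hm'
    apply hpq
    simp at hm'
    linarith
  have hzL : z ^ L = 1 := by
    rw [hz, ← Complex.exp_nat_mul, Complex.exp_eq_one_iff]
    refine ⟨ν - μ, ?_⟩
    have : (L : ℝ) * (q - p) = (ν - μ) * (2 * π) := by rw [hμ, hν]; field_simp
    have h' : (L : ℂ) * ((q - p : ℝ) : ℂ) = (ν - μ) * (2 * π) := by exact_mod_cast this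
    push_cast at h' ⊢
    linear_combination Complex.I * h'
  have hterm (n : Fin L) :
      Complex.exp (Complex.I * ((q - p) * ((n : ℕ) + 1) : ℝ)) = z * z ^ (n : ℕ) := by
    rw [hz, ← pow_succ', ← Complex.exp_nat_mul]
    congr 1
    push_cast
    ring
  simp_rw [hterm]
  rw [← Finset.mul_sum, Fin.sum_univ_eq_sum_range (fun n => z ^ n), geom_sum_eq hz1, hzL]
  simp

lemma inner_planeWave_eq_zero {d L : ℕ} (hL : 0 < L) {k k' : Fin d → ℝ}
    (hk : inMomentumLattice d L k) (hk' : inMomentumLattice d L k') (hne : k ≠ k') :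
    ⟪planeWave d L k, planeWave d L k'⟫_ℂ = 0 := by
  obtain ⟨a, ha⟩ := Function.ne_iff.mp hne
  have hterm (x : Fin d → Fin L) : ⟪planeWave d L k x, planeWave d L k' x⟫_ℂ =
      ((Real.sqrt ((L : ℝ) ^ d) : ℂ))⁻¹ ^ 2 *
        ∏ b, Complex.exp (Complex.I * ((k' b - k b) * ((x b : ℕ) + 1) : ℝ)) := by
    rw [← Complex.exp_sum, ← Finset.mul_sum, ← Complex.ofReal_sum]
    have : ∑ b, (k' b - k b) * ((x b : ℕ) + 1 : ℝ) = kdot d L k' x - kdot d L k x := by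
      simp [kdot, sub_mul, Finset.sum_sub_distrib]
    rw [this]
    simp only [planeWave, RCLike.inner_apply, map_mul, map_inv₀, Complex.conj_ofReal,
      ← Complex.exp_conj, Complex.conj_I]
    rw [mul_mul_mul_comm, ← Complex.exp_add, ← sq]
    congr 2
    push_cast
    ring
  rw [PiLp.inner_apply]
  simp_rw [hterm]
  rw [← Finset.mul_sum,
    ← Fintype.prod_sum fun b (n : Fin L) =>
      Complex.exp (Complex.I * ((k' b - k b) * ((n : ℕ) + 1) : ℝ)),
    Finset.prod_eq_zero (Finset.mem_univ a) (sum_exp_eq_zero hL (hk a) (hk' a) ha), mul_zero]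

/-- For the free Fermi gas eigenstate `Ψ_k` with distinct momenta, the variance of `N_Γ`
satisfies `⟨Ψ_k, N_Γ² Ψ_k⟩ − ⟨Ψ_k, N_Γ Ψ_k⟩² ≤ N (|Γ|/|Λ|)(1 − |Γ|/|Λ|)`. -/
theorem number_operator_variance_bound (d L N : ℕ) (hL : 0 < L)
    {H : Type*} [NormedAddCommGroup H] [InnerProductSpace ℂ H]
    (c cd : (Fin d → Fin L) → (H →ₗ[ℂ] H))
    (hadj : ∀ x φ ψ, ⟪cd x φ, ψ⟫_ℂ = ⟪φ, c x ψ⟫_ℂ)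
    (hcc : ∀ x y, c x * c y + c y * c x = 0)
    (hccd : ∀ x y, c x * cd y + cd y * c x = if x = y then (1 : H →ₗ[ℂ] H) else 0)
    (vac : H) (hvac : ‖vac‖ = 1) (hvac0 : ∀ x, c x vac = 0)
    (k : Fin N → (Fin d → ℝ)) (hk : Function.Injective k)
    (hkK : ∀ j, inMomentumLattice d L (k j))
    (Γ : Finset (Fin d → Fin L)) :
    (⟪(List.ofFn fun j => adag d L cd (k j)).prod vac,
        ((∑ x ∈ Γ, cd x * c x) * (∑ x ∈ Γ, cd x * c x))
          ((List.ofFn fun j => adag d L cd (k j)).prod vac)⟫_ℂ).re -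
      ((⟪(List.ofFn fun j => adag d L cd (k j)).prod vac,
        (∑ x ∈ Γ, cd x * c x)
          ((List.ofFn fun j => adag d L cd (k j)).prod vac)⟫_ℂ).re) ^ 2 ≤
      (N : ℝ) * ((Γ.card : ℝ) / (L : ℝ) ^ d) * (1 - (Γ.card : ℝ) / (L : ℝ) ^ d) := by
  have hcar : IsCAR c cd := ⟨hadj, hcc, hccd⟩
  have hf : Orthonormal ℂ fun j => planeWave d L (k j) :=
    ⟨fun j => norm_planeWave hL _, fun i j hij =>
      inner_planeWave_eq_zero hL (hkK i) (hkK j) (hk.ne hij)⟩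
  have hΨ : (List.ofFn fun j => adag d L cd (k j)).prod vac =
      slater cd vac (List.ofFn fun j => planeWave d L (k j)) := by
    simp [slater, List.map_ofFn, Function.comp_def, creation_planeWave]
  rw [hΨ]
  refine hcar.number_variance_slater_le hvac hvac0 hf Γ fun j => ?_
  simp [norm_planeWave_apply_sq, div_eq_mul_inv]
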